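/- Under the Impartial Anonymous Culture assumption with 2 voters and m candidates, the probability that an election (multiset of 2 votes) is single-peaked equals (C(2m−2, m−1) + 1)/(m! + 1). -/

import Mathlib

def SPwrt {m : ℕ} (V A : Equiv.Perm (Fin m)) : Prop :=
  ∀ c₁ c₂ c₃ : Fin m, ¬(A c₁ < A c₂ ∧ A c₂ < A c₃ ∧ V c₁ < V c₂ ∧ V c₃ < V c₂)

namespace IAC

/-- Single-peakedness in terms of heights (larger is better). -/
def SPh {n : ℕ} (U A : Equiv.Perm (Fin n)) : Prop :=
  ∀ c₁ c₂ c₃ : Fin n, ¬(A c₁ < A c₂ ∧ A c₂ < A c₃ ∧ U c₂ < U c₁ ∧ U c₂ < U c₃)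

def Good {n : ℕ} (s : Equiv.Perm (Fin n)) : Prop := ∃ A, SPh 1 A ∧ SPh s A

/-- Insert a new candidate `0` at value `j`. -/
noncomputable def ins {n : ℕ} (j : Fin (n+1)) (s : Equiv.Perm (Fin n)) : Equiv.Perm (Fin (n+1)) :=
  Equiv.ofBijective (Fin.cons j (fun i => j.succAbove (s i)) : Fin (n+1) → Fin (n+1)) (by
    apply Finite.injective_iff_bijective.1
    rw [Fin.cons_injective_iff]
    constructor
    · rintro ⟨i, hi⟩
      exact Fin.succAbove_ne _ _ hi
    · exact (Fin.succAbove_right_injective).comp s.injective)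

@[simp] lemma ins_zero {n : ℕ} (j : Fin (n+1)) (s : Equiv.Perm (Fin n)) : ins j s 0 = j := by
  simp [ins]

@[simp] lemma ins_succ {n : ℕ} (j : Fin (n+1)) (s : Equiv.Perm (Fin n)) (i : Fin n) :
    ins j s i.succ = j.succAbove (s i) := by
  simp [ins]

lemma ins_inj {n : ℕ} : Function.Injective
    (fun p : Fin (n+1) × Equiv.Perm (Fin n) => ins p.1 p.2) := by
  rintro ⟨j, s⟩ ⟨k, t⟩ h
  have h0 : j = k := by simpa using congrArg (fun e => e 0) h
  subst h0
  have : s = t := by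
    ext i
    have := congrArg (fun e => e i.succ) h
    simp at this
    rw [this]
  rw [this]

lemma ins_bij {n : ℕ} : Function.Bijective
    (fun p : Fin (n+1) × Equiv.Perm (Fin n) => ins p.1 p.2) := by
  rw [Fintype.bijective_iff_injective_and_card]
  refine ⟨ins_inj, ?_⟩
  simp [Fintype.card_perm, Nat.factorial_succ]

lemma exists_ins {n : ℕ} (t : Equiv.Perm (Fin (n+1))) : ∃ j s, t = ins j s := by
  obtain ⟨⟨j, s⟩, h⟩ := ins_bij.2 t
  exact ⟨j, s, h.symm⟩

lemma sA_lt {n : ℕ} (j : Fin (n+1)) (x : Fin n) : j.succAbove x < j ↔ x.val < j.val := by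
  rw [Fin.succAbove_lt_iff_castSucc_lt]; rfl

lemma lt_sA {n : ℕ} (j : Fin (n+1)) (x : Fin n) : j < j.succAbove x ↔ j.val ≤ x.val := by
  rw [Fin.lt_succAbove_iff_le_castSucc]; rfl

def R {n : ℕ} (s A : Equiv.Perm (Fin n)) (j : ℕ) : Prop :=
  ∀ c d, A c < A d → (s c).val < j → s d < s c

lemma SPh_of_ins {n : ℕ} {j a : Fin (n+1)} {s A : Equiv.Perm (Fin n)}
    (h : SPh (ins j s) (ins a A)) : SPh s A := by
  intro c₁ c₂ c₃
  have := h c₁.succ c₂.succ c₃.succ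
  simpa using this

lemma SPh_one_of_ins {n : ℕ} {a : Fin (n+1)} {A : Equiv.Perm (Fin n)}
    (h : SPh 1 (ins a A)) : SPh 1 A := by
  intro c₁ c₂ c₃
  have := h c₁.succ c₂.succ c₃.succ
  simpa using this

lemma SPh_rev {n : ℕ} {U A : Equiv.Perm (Fin n)} (h : SPh U A) : SPh U (A.trans Fin.revPerm) := by
  intro c₁ c₂ c₃
  have := h c₃ c₂ c₁
  simp only [Equiv.trans_apply, Fin.revPerm_apply, Fin.rev_lt_rev]
  tauto

lemma end_of_one {n : ℕ} {a : Fin (n+1)} {A : Equiv.Perm (Fin n)}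
    (h : SPh 1 (ins a A)) : a = 0 ∨ a = Fin.last n := by
  by_contra hc
  push Not at hc
  obtain ⟨c, hcc⟩ := (ins a A).surjective 0
  obtain ⟨d, hd⟩ := (ins a A).surjective (Fin.last n)
  have h1 : (0 : Fin (n+1)) < a := Fin.pos_iff_ne_zero.2 hc.1
  have h2 : a < Fin.last n := Fin.lt_last_iff_ne_last.2 hc.2
  have := h c 0 d
  rw [hcc, hd, ins_zero] at this
  apply this
  refine ⟨h1, h2, ?_, ?_⟩
  · apply Fin.pos_iff_ne_zero.2
    rintro rfl
    rw [ins_zero] at hcc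
    exact hc.1 hcc
  · apply Fin.pos_iff_ne_zero.2
    rintro rfl
    rw [ins_zero] at hd
    exact hc.2 hd

/-- Extending an axis at the left end. -/
lemma SPh_ins_left {n : ℕ} {j : Fin (n+1)} {s A : Equiv.Perm (Fin n)} :
    SPh (ins j s) (ins 0 A) ↔ SPh s A ∧ R s A j := by
  constructor
  · intro h
    refine ⟨SPh_of_ins h, ?_⟩
    intro c d hcd hcj
    have := h 0 c.succ d.succ
    simp [sA_lt] at this
    have h1 := this hcd hcj
    have : s d ≠ s c := by
      intro h; rw [s.injective h] at hcd; exact lt_irrefl _ hcd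
    exact lt_of_le_of_ne h1 this
  · rintro ⟨h, hr⟩ c₁ c₂ c₃ ⟨h1, h2, h3, h4⟩
    rcases Fin.eq_zero_or_eq_succ c₂ with rfl | ⟨c₂, rfl⟩
    · simp at h1
    rcases Fin.eq_zero_or_eq_succ c₃ with rfl | ⟨c₃, rfl⟩
    · simp at h2
    rcases Fin.eq_zero_or_eq_succ c₁ with rfl | ⟨c₁, rfl⟩
    · simp [sA_lt] at h2 h3 h4
      exact absurd (hr c₂ c₃ h2 h3) (not_lt.2 h4.le)
    · simp at h1 h2 h3 h4
      exact h _ _ _ ⟨h1, h2, h3, h4⟩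

lemma SPh_one_ins_left {n : ℕ} {A : Equiv.Perm (Fin n)} (h : SPh 1 A) : SPh 1 (ins 0 A) := by
  rintro c₁ c₂ c₃ ⟨h1, h2, h3, h4⟩
  rcases Fin.eq_zero_or_eq_succ c₂ with rfl | ⟨c₂, rfl⟩
  · simp at h1
  rcases Fin.eq_zero_or_eq_succ c₃ with rfl | ⟨c₃, rfl⟩
  · simp at h2
  rcases Fin.eq_zero_or_eq_succ c₁ with rfl | ⟨c₁, rfl⟩
  · simp at h3
  · simp at h1 h2 h3 h4
    exact h _ _ _ ⟨h1, h2, h3, h4⟩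

lemma SPh_one_ins_right {n : ℕ} {A : Equiv.Perm (Fin n)} (h : SPh 1 A) :
    SPh 1 (ins (Fin.last n) A) := by
  rintro c₁ c₂ c₃ ⟨h1, h2, h3, h4⟩
  rcases Fin.eq_zero_or_eq_succ c₂ with rfl | ⟨c₂, rfl⟩
  · rw [ins_zero] at h2; exact absurd h2 (not_lt.2 (Fin.le_last _))
  rcases Fin.eq_zero_or_eq_succ c₁ with rfl | ⟨c₁, rfl⟩
  · simp at h3
  rcases Fin.eq_zero_or_eq_succ c₃ with rfl | ⟨c₃, rfl⟩
  · simp at h4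
  · simp at h1 h2 h3 h4
    exact h _ _ _ ⟨h1, h2, h3, h4⟩

lemma SPh_ins_right_zero {n : ℕ} {s A : Equiv.Perm (Fin n)} (h : SPh s A) :
    SPh (ins 0 s) (ins (Fin.last n) A) := by
  rintro c₁ c₂ c₃ ⟨h1, h2, h3, h4⟩
  rcases Fin.eq_zero_or_eq_succ c₂ with rfl | ⟨c₂, rfl⟩
  · rw [ins_zero] at h2; exact absurd h2 (not_lt.2 (Fin.le_last _))
  rcases Fin.eq_zero_or_eq_succ c₁ with rfl | ⟨c₁, rfl⟩
  · simp at h3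
  rcases Fin.eq_zero_or_eq_succ c₃ with rfl | ⟨c₃, rfl⟩
  · simp at h4
  · simp at h1 h2 h3 h4
    exact h _ _ _ ⟨h1, h2, h3, h4⟩

lemma good_ins_iff {n : ℕ} {j : Fin (n+1)} {s : Equiv.Perm (Fin n)} :
    Good (ins j s) ↔ ∃ A, SPh 1 A ∧ SPh s A ∧ R s A j := by
  constructor
  · rintro ⟨A', h1, h2⟩
    have key : ∀ B : Equiv.Perm (Fin (n+1)), B 0 = 0 → SPh 1 B → SPh (ins j s) B →
        ∃ A, SPh 1 A ∧ SPh s A ∧ R s A j := by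
      intro B hB0 hB1 hB2
      obtain ⟨a, A, rfl⟩ := exists_ins B
      rw [ins_zero] at hB0
      subst hB0
      exact ⟨A, SPh_one_of_ins hB1, SPh_ins_left.1 hB2⟩
    obtain ⟨a, A, rfl⟩ := exists_ins A'
    rcases end_of_one h1 with rfl | rfl
    · exact key _ (ins_zero _ _) h1 h2
    · exact key _ (by simp) (SPh_rev h1) (SPh_rev h2)
  · rintro ⟨A, h1, h2, h3⟩
    exact ⟨ins 0 A, SPh_one_ins_left h1, SPh_ins_left.2 ⟨h2, h3⟩⟩

lemma good_of_ins {n : ℕ} {j : Fin (n+1)} {s : Equiv.Perm (Fin n)} (h : Good (ins j s)) :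
    Good s := by
  obtain ⟨A, h1, h2, _⟩ := good_ins_iff.1 h
  exact ⟨A, h1, h2⟩

lemma good_ins_zero {n : ℕ} {s : Equiv.Perm (Fin n)} (h : Good s) : Good (ins 0 s) := by
  obtain ⟨A, h1, h2⟩ := h
  exact good_ins_iff.2 ⟨A, h1, h2, fun c d _ h => by simp at h⟩

lemma good_c {n : ℕ} {s : Equiv.Perm (Fin n)} {j : Fin (n+1)} (hj : j ≠ 0) (h : Good (ins j s))
    (k : Fin (n+2)) : Good (ins k (ins j s)) ↔ k.val ≤ j.val ∨ j.val = n := by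
  constructor
  · intro hk
    obtain ⟨A', h1, h2, h3⟩ := good_ins_iff.1 hk
    by_contra hc
    push Not at hc
    obtain ⟨hc1, hc2⟩ := hc
    obtain ⟨a, A, rfl⟩ := exists_ins A'
    rcases end_of_one h1 with rfl | rfl
    · obtain ⟨d, hd⟩ := (ins j s).surjective (Fin.last n)
      have hd0 : d ≠ 0 := by
        rintro rfl
        rw [ins_zero] at hd
        apply hc2; rw [hd]; simp
      obtain ⟨e, rfl⟩ := Fin.exists_succ_eq.2 hd0
      have := h3 0 e.succ (by simp) (by simpa using hc1)
      rw [hd, ins_zero] at this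
      exact absurd this (not_lt.2 (Fin.le_last _))
    · obtain ⟨d, hd⟩ := (ins j s).surjective 0
      have hd0 : d ≠ 0 := by
        rintro rfl
        rw [ins_zero] at hd
        exact hj hd
      obtain ⟨e, rfl⟩ := Fin.exists_succ_eq.2 hd0
      have := h3 e.succ 0 (by rw [ins_zero, ins_succ, sA_lt]; simp) (by rw [hd, Fin.val_zero]; omega)
      rw [hd] at this
      simp at this
  · intro hk
    obtain ⟨A, h1, h2, h3⟩ := good_ins_iff.1 h
    refine good_ins_iff.2 ⟨ins 0 A, SPh_one_ins_left h1, SPh_ins_left.2 ⟨h2, h3⟩, ?_⟩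
    intro c d hcd hck
    rcases Fin.eq_zero_or_eq_succ d with rfl | ⟨d, rfl⟩
    · simp at hcd
    rcases Fin.eq_zero_or_eq_succ c with rfl | ⟨c, rfl⟩
    · rw [ins_zero] at hck
      rw [ins_zero, ins_succ, sA_lt]
      have := (s d).isLt
      omega
    · simp at hcd hck ⊢
      apply h3 c d hcd
      rcases hk with hk | hk
      · rw [← sA_lt, Fin.lt_def]; omega
      · have := (s c).isLt
        omega

lemma good_d {n : ℕ} {s : Equiv.Perm (Fin n)} (k : Fin (n+1)) :
    Good (ins k.succ (ins 0 s)) ↔ Good (ins k s) := by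
  constructor
  · intro hk
    obtain ⟨A', h1, h2, h3⟩ := good_ins_iff.1 hk
    obtain ⟨a, A, rfl⟩ := exists_ins A'
    refine good_ins_iff.2 ⟨A, SPh_one_of_ins h1, SPh_of_ins h2, ?_⟩
    intro c d hcd hck
    have := h3 c.succ d.succ (by simpa using hcd) (by simpa using hck)
    simpa using this
  · intro hk
    obtain ⟨A, h1, h2, h3⟩ := good_ins_iff.1 hk
    refine good_ins_iff.2 ⟨ins (Fin.last n) A, SPh_one_ins_right h1, SPh_ins_right_zero h2, ?_⟩
    intro c d hcd hck
    rcases Fin.eq_zero_or_eq_succ c with rfl | ⟨c, rfl⟩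
    · rw [ins_zero] at hcd; exact absurd hcd (not_lt.2 (Fin.le_last _))
    rcases Fin.eq_zero_or_eq_succ d with rfl | ⟨d, rfl⟩
    · simp
    · simp at hcd hck ⊢
      exact h3 c d hcd hck

open Classical in
noncomputable def cnt : (k : ℕ) → {n : ℕ} → Equiv.Perm (Fin n) → ℤ
  | 0, _, s => if Good s then 1 else 0
  | k+1, _, s => ∑ j, cnt k (ins j s)

lemma cnt_bad (k : ℕ) : ∀ {n : ℕ} (s : Equiv.Perm (Fin n)), ¬ Good s → cnt k s = 0 := by
  induction k with
  | zero => intro n s h; simp [cnt, h]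
  | succ k ih =>
    intro n s h
    rw [cnt]
    exact Finset.sum_eq_zero fun j _ => ih _ fun hg => h (good_of_ins hg)

lemma sum_cnt (k : ℕ) : ∀ n m : ℕ, n + k = m →
    ∑ s : Equiv.Perm (Fin n), cnt k s = ∑ s : Equiv.Perm (Fin m), cnt 0 s := by
  induction k with
  | zero => rintro n m rfl; rfl
  | succ k ih =>
    intro n m h
    rw [← ih (n+1) m (by omega)]
    simp_rw [cnt]
    rw [Finset.sum_comm, ← Fintype.sum_prod_type']
    exact Fintype.sum_bijective _ ins_bij _ _ fun _ => rfl

def T : ℕ → ℕ → ℤ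
  | 0, _ => 1
  | k+1, q => (Nat.choose (2*k+2+q) (k+1) : ℤ) - Nat.choose (2*k+2+q) k

lemma T_step (k q : ℕ) : T (k+1) (q+1) = T (k+1) q + T k (q+2) := by
  cases k with
  | zero => simp [T]; ring
  | succ k =>
    simp only [T]
    have e1 : 2*(k+1)+2+(q+1) = (2*k+4+q)+1 := by ring
    have e2 : 2*(k+1)+2+q = 2*k+4+q := by ring
    have e3 : 2*k+2+(q+2) = 2*k+4+q := by ring
    rw [e1, e2, e3, Nat.choose_succ_succ (2*k+4+q) (k+1), Nat.choose_succ_succ (2*k+4+q) k]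
    push_cast; ring

lemma T_zero (k : ℕ) : T (k+1) 0 = T k 1 := by
  cases k with
  | zero => simp [T]
  | succ k =>
    simp only [T]
    have e1 : 2*(k+1)+2+0 = (2*k+3)+1 := by ring
    have e3 : 2*k+2+1 = 2*k+3 := by ring
    have h : Nat.choose (2*k+3) (k+2) = Nat.choose (2*k+3) (k+1) :=
      Nat.choose_symm_of_eq_add (by ring)
    rw [e1, e3, Nat.choose_succ_succ (2*k+3) (k+1), Nat.choose_succ_succ (2*k+3) k]
    push_cast
    rw [show (k+1).succ = k+2 from rfl, h]
    simp only [Nat.succ_eq_add_one]; ring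

lemma T_sum (k q : ℕ) : T (k+1) q = T k (q+1) + ∑ i ∈ Finset.range q, T k (i+1) := by
  induction q with
  | zero => simp [T_zero]
  | succ q ih => rw [T_step, ih, Finset.sum_range_succ]; ring

lemma F_sum (k q : ℕ) : (Nat.choose (2*(k+1)+q) (k+1) : ℤ) =
    2 * Nat.choose (2*k+(q+1)) k + ∑ i ∈ Finset.range q, T k (i+1) := by
  have h := T_sum k q
  have h2 : ∑ i ∈ Finset.range q, T k (i+1) = T (k+1) q - T k (q+1) := by rw [h]; ring
  rw [h2]
  cases k with
  | zero => simp [T]; ring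
  | succ k =>
    simp only [T]
    have e1 : 2*(k+1+1)+q = (2*k+3+q)+1 := by ring
    have e2 : 2*(k+1)+(q+1) = 2*k+3+q := by ring
    have e3 : 2*(k+1)+2+q = (2*k+3+q)+1 := by ring
    have e4 : 2*k+2+(q+1) = 2*k+3+q := by ring
    rw [e1, e2, e3, e4, Nat.choose_succ_succ (2*k+3+q) k]
    push_cast; ring

def Lab {n : ℕ} (s : Equiv.Perm (Fin n)) (p : ℕ) : Prop :=
  ∀ k : Fin (n+1), Good (ins k s) ↔ k.val < p

lemma lab_zero {n : ℕ} {s : Equiv.Perm (Fin n)} {p : ℕ} (hg : Good s) (h : Lab s p) :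
    Lab (ins 0 s) (p+1) := by
  intro k
  rcases Fin.eq_zero_or_eq_succ k with rfl | ⟨k, rfl⟩
  · simp [good_ins_zero (good_ins_zero hg)]
  · rw [good_d, h k]; simp

lemma lab_mid {n : ℕ} {s : Equiv.Perm (Fin n)} {j : Fin (n+1)} (hj : j ≠ 0) (hn : j.val ≠ n)
    (h : Good (ins j s)) : Lab (ins j s) (j.val+1) := by
  intro k
  rw [good_c hj h]; omega

lemma lab_last {n : ℕ} {s : Equiv.Perm (Fin n)} {j : Fin (n+1)} (hj : j ≠ 0) (hn : j.val = n)
    (h : Good (ins j s)) : Lab (ins j s) (n+2) := by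
  intro k
  rw [good_c hj h]; omega

lemma cnt_part (k : ℕ) : ∀ {n q : ℕ} (s : Equiv.Perm (Fin n)), Good s → q + 1 ≤ n →
    Lab s (q+1) → cnt k s = T k q := by
  induction k with
  | zero => intro n q s hg _ _; simp [cnt, T, hg]
  | succ k ih =>
    intro n q s hg hq hl
    rw [cnt, Fin.sum_univ_succ, ih (q := q+1) _ (good_ins_zero hg) (by omega) (lab_zero hg hl),
      T_sum]
    congr 1
    have : ∀ i : Fin n, cnt k (ins i.succ s) = if i.val < q then T k (i.val+1) else 0 := by
      intro i
      split_ifs with hi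
      · have hG : Good (ins i.succ s) := (hl _).2 (by simp; exact hi)
        apply ih _ hG (by omega)
        have := lab_mid (Fin.succ_ne_zero i) (by simp; omega) hG
        simpa using this
      · apply cnt_bad
        rw [hl]; simp; omega
    simp_rw [this]
    rw [Fin.sum_univ_eq_sum_range (fun i => if i < q then T k (i+1) else 0) n]
    rw [← Finset.sum_filter]
    congr 1
    ext i; simp; omega

lemma cnt_full (k : ℕ) : ∀ {q : ℕ} (s : Equiv.Perm (Fin (q+1))), Good s → Lab s (q+2) →
    cnt k s = Nat.choose (2*k+q) k := by
  induction k with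
  | zero => intro q s hg _; simp [cnt, hg]
  | succ k ih =>
    intro q s hg hl
    rw [cnt, Fin.sum_univ_succ, ih _ (good_ins_zero hg) (lab_zero hg hl), Fin.sum_univ_castSucc,
      ih (q := q+1) _ ((hl _).2 (by simp))
        (lab_last (Fin.succ_ne_zero _) (by simp) ((hl _).2 (by simp))), F_sum]
    have : ∀ i : Fin q, cnt k (ins i.castSucc.succ s) = T k (i.val+1) := by
      intro i
      have hG : Good (ins i.castSucc.succ s) := (hl _).2 (by simp)
      apply cnt_part k _ hG (by omega)
      have := lab_mid (Fin.succ_ne_zero i.castSucc) (by simp; omega) hG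
      simpa using this
    simp_rw [this]
    rw [Fin.sum_univ_eq_sum_range (fun i => T k (i+1)) q]
    ring

lemma good_small {n : ℕ} (hn : n ≤ 2) (s : Equiv.Perm (Fin n)) : Good s := by
  have : ∀ U : Equiv.Perm (Fin n), SPh U 1 := by
    intro U a b c
    simp only [Equiv.Perm.one_apply, Fin.lt_def]
    omega
  exact ⟨1, this _, this _⟩

open Classical in
lemma card_good (m : ℕ) (hm : 1 ≤ m) :
    (Finset.univ.filter (fun s : Equiv.Perm (Fin m) => Good s)).card
      = Nat.choose (2*m-2) (m-1) := by
  obtain ⟨k, rfl⟩ := Nat.exists_eq_add_of_le hm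
  have h := sum_cnt k 1 (1+k) rfl
  rw [Fintype.sum_unique, cnt_full (q := 0) k _ (good_small (by omega) _)
    (fun j => by simp [good_small (le_refl 2)]; omega)] at h
  simp only [cnt, Finset.sum_boole] at h
  have h' : Nat.choose (2*k+0) k = (Finset.univ.filter
    (fun s : Equiv.Perm (Fin (1+k)) => Good s)).card := by exact_mod_cast h
  rw [← h']
  congr 1 <;> omega

lemma SPwrt_iff {m : ℕ} (V A : Equiv.Perm (Fin m)) : SPwrt V A ↔ SPh (Fin.revPerm * V) A := by
  simp only [SPwrt, SPh, Equiv.Perm.mul_apply, Fin.revPerm_apply, Fin.rev_lt_rev]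

lemma SPh_mul {m : ℕ} {U A : Equiv.Perm (Fin m)} (P : Equiv.Perm (Fin m)) (h : SPh U A) :
    SPh (U * P) (A * P) := fun a b c => h (P a) (P b) (P c)

lemma rel_iff {m : ℕ} (V W : Equiv.Perm (Fin m)) :
    (∃ A, SPwrt V A ∧ SPwrt W A) ↔ Good (Fin.revPerm * W * (Fin.revPerm * V)⁻¹) := by
  simp only [SPwrt_iff]
  constructor
  · rintro ⟨A, h1, h2⟩
    refine ⟨A * (Fin.revPerm * V)⁻¹, ?_, SPh_mul _ h2⟩
    have := SPh_mul (Fin.revPerm * V)⁻¹ h1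
    rwa [mul_inv_cancel] at this
  · rintro ⟨A, h1, h2⟩
    refine ⟨A * (Fin.revPerm * V), ?_, ?_⟩
    · have := SPh_mul (Fin.revPerm * V) h1
      rwa [one_mul] at this
    · have := SPh_mul (Fin.revPerm * V) h2
      rwa [inv_mul_cancel_right] at this

open Classical in
lemma card_rel (m : ℕ) (hm : 1 ≤ m) (V : Equiv.Perm (Fin m)) :
    (Finset.univ.filter (fun W : Equiv.Perm (Fin m) => ∃ A, SPwrt V A ∧ SPwrt W A)).card
      = Nat.choose (2*m-2) (m-1) := by
  rw [← card_good m hm]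
  apply Finset.card_bijective
    ((Equiv.mulLeft Fin.revPerm).trans (Equiv.mulRight (Fin.revPerm * V)⁻¹)) (Equiv.bijective _)
  intro W
  simp only [Finset.mem_filter, Finset.mem_univ, true_and, rel_iff]
  rfl

lemma pair_eq {α : Type*} (a b c d : α) :
    (({a, b} : Multiset α) = {c, d}) ↔ (a = c ∧ b = d) ∨ (a = d ∧ b = c) := by
  constructor
  · intro h
    have h' : a ::ₘ ({b} : Multiset α) = c ::ₘ {d} := h
    rw [Multiset.cons_eq_cons] at h'
    rcases h' with ⟨h1, h2⟩ | ⟨_, cs, h1, h2⟩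
    · exact Or.inl ⟨h1, Multiset.singleton_inj.1 h2⟩
    · rw [Multiset.singleton_eq_cons_iff] at h1 h2
      exact Or.inr ⟨h2.1.symm, h1.1⟩
  · rintro (⟨rfl, rfl⟩ | ⟨rfl, rfl⟩)
    · rfl
    · exact Multiset.pair_comm _ _

open Classical in
lemma count_pairs {α : Type*} [Fintype α] (r : α → α → Prop) (hr : ∀ a, r a a)
    (hs : ∀ a b, r a b → r b a) (g : ℕ)
    (hg : ∀ a, (Finset.univ.filter (fun b => r a b)).card = g)
    (S : Set (Multiset α)) (hS : ∀ M, M ∈ S ↔ ∃ a b, M = {a, b} ∧ r a b) :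
    Fintype.card α * (g + 1) = S.ncard * 2 := by
  let P : Finset (α × α) := Finset.univ.filter (fun p => r p.1 p.2)
  have hP : P.card = Fintype.card α * g := by
    have : P = (Finset.univ.sigma (fun a => Finset.univ.filter (fun b => r a b))).map
        (Equiv.sigmaEquivProd α α).toEmbedding := by
      ext ⟨a, b⟩
      simp [P]
    rw [this, Finset.card_map, Finset.card_sigma]
    simp [hg]
  let Q : Finset ((α × α) ⊕ α) := P.disjSum Finset.univ
  let f : (α × α) ⊕ α → Multiset α := Sum.elim (fun p => {p.1, p.2}) (fun a => {a, a})
  have hQ : Q.card = Fintype.card α * (g+1) := by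
    rw [Finset.card_disjSum, hP, Finset.card_univ]; ring
  have hSi : S = ↑(Q.image f) := by
    ext M
    rw [hS]
    simp only [Finset.coe_image, Set.mem_image, Finset.mem_coe]
    constructor
    · rintro ⟨a, b, rfl, h⟩
      exact ⟨Sum.inl (a, b), by simp [Q, P, h], rfl⟩
    · rintro ⟨x | a, hx, rfl⟩
      · exact ⟨x.1, x.2, rfl, by simpa [Q, P] using hx⟩
      · exact ⟨a, a, rfl, hr a⟩
  rw [hSi, Set.ncard_coe_finset, ← hQ]
  rw [Finset.card_eq_sum_card_image f Q]
  apply Finset.sum_const_nat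
  intro M hM
  have hM' : M ∈ S := by rw [hSi]; exact_mod_cast hM
  obtain ⟨a, b, rfl, hab⟩ := (hS M).1 hM'
  rw [Finset.card_eq_two]
  by_cases hne : a = b
  · subst hne
    refine ⟨Sum.inl (a, a), Sum.inr a, by simp, ?_⟩
    ext x
    rcases x with ⟨c, d⟩ | c
    · simp only [Finset.mem_filter, f, Sum.elim_inl, pair_eq, Finset.mem_insert,
        Finset.mem_singleton, Sum.inl.injEq, Prod.mk.injEq, reduceCtorEq, or_false, Q, P,
        Finset.inl_mem_disjSum, Finset.mem_univ, true_and]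
      constructor
      · tauto
      · rintro ⟨rfl, rfl⟩
        exact ⟨hr _, by simp⟩
    · simp only [Finset.mem_filter, f, Sum.elim_inr, pair_eq, Finset.mem_insert,
        Finset.mem_singleton, reduceCtorEq, false_or, Sum.inr.injEq, Q,
        Finset.inr_mem_disjSum, Finset.mem_univ, true_and]
      tauto
  · refine ⟨Sum.inl (a, b), Sum.inl (b, a), by simp [hne], ?_⟩
    ext x
    rcases x with ⟨c, d⟩ | c
    · simp only [Finset.mem_filter, f, Sum.elim_inl, pair_eq, Finset.mem_insert,
        Finset.mem_singleton, Sum.inl.injEq, Prod.mk.injEq, Q, P,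
        Finset.inl_mem_disjSum, Finset.mem_univ, true_and]
      constructor
      · tauto
      · rintro (⟨rfl, rfl⟩ | ⟨rfl, rfl⟩)
        · exact ⟨hab, by simp⟩
        · exact ⟨hs _ _ hab, by simp⟩
    · simp only [Finset.mem_filter, f, Sum.elim_inr, pair_eq, Finset.mem_insert,
        Finset.mem_singleton, reduceCtorEq, or_false, iff_false]
      rintro ⟨_, ⟨h1, h2⟩ | ⟨h1, h2⟩⟩
      · exact hne (h1.symm.trans h2)
      · exact hne (h2.symm.trans h1)

end IAC

/-- Under the Impartial Anonymous Culture assumption with 2 voters and `m ≥ 1`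
candidates (elections are multisets of 2 votes, all equally likely), the
probability that an election is single-peaked equals
`(C(2m−2, m−1) + 1)/(m! + 1)`. -/
theorem iac_two_voters (m : ℕ) (hm : 1 ≤ m) :
    (({M : Multiset (Equiv.Perm (Fin m)) |
        Multiset.card M = 2 ∧ ∃ A, ∀ V ∈ M, SPwrt V A}.ncard : ℝ) /
      ({M : Multiset (Equiv.Perm (Fin m)) | Multiset.card M = 2}.ncard : ℝ)) =
      ((Nat.choose (2 * m - 2) (m - 1) : ℝ) + 1) / ((Nat.factorial m : ℝ) + 1) := by
  classical
  have h1 := IAC.count_pairs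
    (fun V W : Equiv.Perm (Fin m) => ∃ A, SPwrt V A ∧ SPwrt W A)
    (fun V => ⟨V, by
      have : ∀ a b c : Fin m, ¬(V a < V b ∧ V b < V c ∧ V a < V b ∧ V c < V b) := by
        intro a b c h
        exact lt_asymm h.2.1 h.2.2.2
      exact ⟨this, this⟩⟩)
    (fun V W ⟨A, h, h'⟩ => ⟨A, h', h⟩) (Nat.choose (2 * m - 2) (m - 1))
    (fun V => by convert IAC.card_rel m hm V)
    {M : Multiset (Equiv.Perm (Fin m)) | Multiset.card M = 2 ∧ ∃ A, ∀ V ∈ M, SPwrt V A}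
    (by
      intro M
      simp only [Set.mem_setOf_eq, Multiset.card_eq_two]
      constructor
      · rintro ⟨⟨a, b, rfl⟩, A, hA⟩
        exact ⟨a, b, rfl, A, hA a (by simp), hA b (by simp)⟩
      · rintro ⟨a, b, rfl, A, ha, hb⟩
        refine ⟨⟨a, b, rfl⟩, A, ?_⟩
        intro V hV
        simp at hV
        rcases hV with rfl | rfl <;> assumption)
  have h2 := IAC.count_pairs (fun _ _ : Equiv.Perm (Fin m) => True) (fun _ => trivial)
    (fun _ _ _ => trivial) (Nat.factorial m)
    (fun _ => by simp [Fintype.card_perm])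
    {M : Multiset (Equiv.Perm (Fin m)) | Multiset.card M = 2}
    (by intro M; simp only [Set.mem_setOf_eq, Multiset.card_eq_two, and_true])
  rw [Fintype.card_perm, Fintype.card_fin] at h1 h2
  have hf : (0 : ℝ) < (Nat.factorial m : ℝ) := by exact_mod_cast Nat.factorial_pos m
  generalize Set.ncard {M : Multiset (Equiv.Perm (Fin m)) |
    Multiset.card M = 2 ∧ ∃ A, ∀ V ∈ M, SPwrt V A} = x at h1 ⊢
  generalize Set.ncard {M : Multiset (Equiv.Perm (Fin m)) | Multiset.card M = 2} = y at h2 ⊢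
  have h1' : (Nat.factorial m : ℝ) * ((Nat.choose (2 * m - 2) (m - 1) : ℝ) + 1) = (x : ℝ) * 2 := by
    exact_mod_cast h1
  have h2' : (Nat.factorial m : ℝ) * ((Nat.factorial m : ℝ) + 1) = (y : ℝ) * 2 := by
    exact_mod_cast h2
  rw [← mul_div_mul_right _ _ (two_ne_zero (α := ℝ)), ← h1', ← h2',
    mul_div_mul_left _ _ hf.ne']
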